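/- arXiv:1810.03953 — 3 statements merged into one kernel-verified Lean document; each statement's English description precedes it below -/
import Mathlib

section
/- Let B : ℝ^d × ℝ^d → ℝ^{d×d} be a C¹ family of skew-symmetric matrices (B_{ij} = −B_{ji}) depending on both q and p, and let D_i be the vector field D_i(x) := (e_i, (B_{i1}(x), …, B_{id}(x))) (i.e. D_i = P_i + Σ_j B_{ij} Q^j). Then the flat Levi-Civita bracket of two horizontal fields is ⟦D_i, D_j⟧(x) = Σ_k 𝓗_{ijk}(x) · Q^k + Σ_k (∂B_{ij}/∂p_k)(x) · D_k(x), where 𝓗_{ijk} := ∂B_{jk}/∂q^i + ∂B_{ki}/∂q^j + ∂B_{ij}/∂q^k + Σ_m (B_{im} ∂B_{jk}/∂p_m + B_{jm} ∂B_{ki}/∂p_m + B_{km} ∂B_{ij}/∂p_m) is the covariant H-flux; in particular the obstruction to weak integrability of the B-twisted horizontal distribution is given by the covariant H-flux together with the f-flux ∂B_{ij}/∂p_k. -/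
open Matrix

/-- The flat split-signature metric `η₀((a,b),(a',b')) = ⟨a,b'⟩ + ⟨b,a'⟩` on `ℝ^d × ℝ^d`. -/
def eta0 {d : ℕ} (u v : (Fin d → ℝ) × (Fin d → ℝ)) : ℝ := u.1 ⬝ᵥ v.2 + u.2 ⬝ᵥ v.1

/-- The Lie bracket of vector fields: `[X,Y](x) = DY(x)(X(x)) − DX(x)(Y(x))`. -/
noncomputable def lieBracket {E : Type*} [NormedAddCommGroup E] [NormedSpace ℝ E]
    (X Y : E → E) : E → E :=
  fun x => fderiv ℝ Y x (X x) - fderiv ℝ X x (Y x)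

theorem clm_snd_decomp {d : ℕ} (L : ((Fin d → ℝ) × (Fin d → ℝ)) →L[ℝ] ℝ) (a b : Fin d → ℝ) :
    L (a, b) = L (a, 0) + ∑ k, b k * L (0, Pi.single k 1) := by
  have h2 : (L.comp (ContinuousLinearMap.inr ℝ _ _)) b
      = ∑ k, b k * L (0, Pi.single k 1) := by
    conv_lhs => rw [pi_eq_sum_univ' b]
    rw [map_sum]
    refine Finset.sum_congr rfl fun k _ => ?_
    rw [map_smul, smul_eq_mul]
    congr 1
  rw [← h2]
  simp [← map_add]

theorem clm_fst_decomp {d : ℕ} (L : ((Fin d → ℝ) × (Fin d → ℝ)) →L[ℝ] ℝ) (a : Fin d → ℝ) :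
    L (a, 0) = ∑ k, a k * L (Pi.single k 1, 0) := by
  have h2 : (L.comp (ContinuousLinearMap.inl ℝ _ _)) a
      = ∑ k, a k * L (Pi.single k 1, 0) := by
    conv_lhs => rw [pi_eq_sum_univ' a]
    rw [map_sum]
    refine Finset.sum_congr rfl fun k _ => ?_
    rw [map_smul, smul_eq_mul]
    congr 1
  rw [← h2]
  simp

/-- For a C¹ family of skew-symmetric matrices `B(q,p)` and the
horizontal fields `D_i = P_i + Σ_j B_{ij} Q^j`, the flat Levi-Civita bracket
(characterized by `η₀(⟦X,Y⟧(x),Z) = η₀([X,Y](x),Z) + η₀(DX(x)Z, Y(x))`) satisfies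
`⟦D_i, D_j⟧ = Σ_k 𝓗_{ijk} Q^k + Σ_k (∂B_{ij}/∂p_k) D_k`, with `𝓗` the covariant
`H`-flux. -/
theorem stmt15 {d : ℕ}
    (B : Fin d → Fin d → (((Fin d → ℝ) × (Fin d → ℝ)) → ℝ))
    (hB1 : ∀ i j : Fin d, ContDiff ℝ 1 (B i j))
    (hskew : ∀ (i j : Fin d) (x : (Fin d → ℝ) × (Fin d → ℝ)), B i j x = -(B j i x))
    (D : Fin d → ((Fin d → ℝ) × (Fin d → ℝ)) → ((Fin d → ℝ) × (Fin d → ℝ)))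
    (hD : ∀ (i : Fin d) (x : (Fin d → ℝ) × (Fin d → ℝ)),
      D i x = (Pi.single i 1, fun j => B i j x))
    (H : Fin d → Fin d → Fin d → (((Fin d → ℝ) × (Fin d → ℝ)) → ℝ))
    (hH : ∀ (i j k : Fin d) (x : (Fin d → ℝ) × (Fin d → ℝ)),
      H i j k x = fderiv ℝ (B j k) x (Pi.single i 1, 0)
        + fderiv ℝ (B k i) x (Pi.single j 1, 0)
        + fderiv ℝ (B i j) x (Pi.single k 1, 0)
        + ∑ m, (B i m x * fderiv ℝ (B j k) x (0, Pi.single m 1)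
          + B j m x * fderiv ℝ (B k i) x (0, Pi.single m 1)
          + B k m x * fderiv ℝ (B i j) x (0, Pi.single m 1))) :
    ∀ (i j : Fin d) (x Z : (Fin d → ℝ) × (Fin d → ℝ)),
      eta0 (∑ k, H i j k x • (((0, Pi.single k 1)) : (Fin d → ℝ) × (Fin d → ℝ))
          + ∑ k, fderiv ℝ (B i j) x (0, Pi.single k 1) • D k x) Z
        = eta0 (lieBracket (D i) (D j) x) Z + eta0 (fderiv ℝ (D i) x Z) (D j x) := by
  intro i j x Z
  have hdiff : ∀ i j, DifferentiableAt ℝ (B i j) x := fun i j =>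
    ((hB1 i j).differentiable (by norm_num)) x
  have hfd : ∀ i v, fderiv ℝ (D i) x v = (0, fun k => fderiv ℝ (B i k) x v) := by
    intro i v
    have hDi : D i = fun x => (Pi.single i 1, fun j => B i j x) := funext (hD i)
    have h1 : HasFDerivAt (D i) ((0 : _ →L[ℝ] (Fin d → ℝ)).prod
        (ContinuousLinearMap.pi fun k => fderiv ℝ (B i k) x)) x := by
      rw [hDi]
      exact (hasFDerivAt_const _ _).prodMk
        (hasFDerivAt_pi.2 fun k => (hdiff i k).hasFDerivAt)
    rw [h1.fderiv]
    rfl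
  have hsk : ∀ k v, fderiv ℝ (B i k) x v = - fderiv ℝ (B k i) x v := by
    intro k v
    have : B i k = fun y => -(B k i y) := funext (hskew i k)
    rw [this, fderiv_fun_neg]
    rfl
  obtain ⟨a, b⟩ := Z
  have hS : ∀ k, (∑ m, fderiv ℝ (B i j) x (0, Pi.single m 1) * B m k x)
      = - ∑ m, B k m x * fderiv ℝ (B i j) x (0, Pi.single m 1) := by
    intro k
    rw [← Finset.sum_neg_distrib]
    refine Finset.sum_congr rfl fun m _ => ?_
    rw [hskew m k]; ring
  have hvec : (∑ k, H i j k x • (((0, Pi.single k 1)) : (Fin d → ℝ) × (Fin d → ℝ))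
          + ∑ k, fderiv ℝ (B i j) x (0, Pi.single k 1) • D k x)
      = (fun k => fderiv ℝ (B i j) x (0, Pi.single k 1),
         fun k => H i j k x + ∑ m, fderiv ℝ (B i j) x (0, Pi.single m 1) * B m k x) := by
    ext k
    · simp [hD, Prod.fst_sum, Finset.sum_apply, Pi.single_apply]
    · simp [hD, Prod.snd_sum, Finset.sum_apply, Pi.single_apply]
  have hlast : eta0 (fderiv ℝ (D i) x (a, b)) (D j x) = fderiv ℝ (B i j) x (a, b) := by
    rw [hfd, hD]
    simp [eta0]
  have hlie : lieBracket (D i) (D j) x = (0, fun k =>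
      fderiv ℝ (B j k) x (D i x) + fderiv ℝ (B k i) x (D j x)) := by
    unfold lieBracket
    rw [hfd, hfd]
    ext k
    · simp
    · simp [hsk k]
  rw [hlast, hvec, hlie, clm_snd_decomp _ a b, clm_fst_decomp _ a]
  simp only [eta0, dotProduct, hS, hH, hD, Pi.zero_apply, zero_mul, Finset.sum_const_zero, zero_add]
  have e1 : ∀ u v w z y : ℝ, v = w + z → u = y → u + v = w + (z + y) := by
    intro u v w z y h1 h2
    rw [h1, h2]; ring
  apply e1
  · rw [← Finset.sum_add_distrib]
    refine Finset.sum_congr rfl fun k _ => ?_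
    rw [clm_snd_decomp _ (Pi.single i 1) (fun m => B i m x),
      clm_snd_decomp _ (Pi.single j 1) (fun m => B j m x)]
    simp only [Finset.sum_add_distrib]
    ring
  · exact Finset.sum_congr rfl fun k _ => mul_comm _ _
end

section
/- Let β : ℝ^d × ℝ^d → ℝ^{d×d} be a C¹ family of skew-symmetric matrices (β^{ij} = −β^{ji}) depending on both q and p, and let D̃^i be the vector field D̃^i(x) := ((β^{i1}(x), …, β^{id}(x)), e_i) (i.e. D̃^i = Q^i + Σ_j β^{ij} P_j). Then the flat Levi-Civita bracket of two β-twisted vertical fields is ⟦D̃^i, D̃^j⟧(x) = Σ_k (∂β^{ij}/∂q^k)(x) · D̃^k(x) + Σ_k 𝓡^{ijk}(x) · P_k, where 𝓡^{ijk} := ∂β^{jk}/∂p_i + ∂β^{ki}/∂p_j + ∂β^{ij}/∂p_k + Σ_l (β^{il} ∂β^{jk}/∂q^l + β^{jl} ∂β^{ki}/∂q^l + β^{kl} ∂β^{ij}/∂q^l); in particular the obstruction to weak integrability is the locally non-geometric R-flux 𝓡^{ijk}, while the globally non-geometric Q-flux ∂β^{ij}/∂q^k gives the involutive component. -/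
open Matrix

theorem clm_decomp {d : ℕ} (L : ((Fin d → ℝ) × (Fin d → ℝ)) →L[ℝ] ℝ) (a b : Fin d → ℝ) :
    L (a, b) = ∑ l, a l * L (Pi.single l 1, 0) + ∑ l, b l * L (0, Pi.single l 1) := by
  have h1 : (a, b) = ContinuousLinearMap.inl ℝ (Fin d → ℝ) (Fin d → ℝ) a
      + ContinuousLinearMap.inr ℝ (Fin d → ℝ) (Fin d → ℝ) b := by simp
  have key : ∀ (M : (Fin d → ℝ) →L[ℝ] ℝ) (c : Fin d → ℝ),
      M c = ∑ l, c l * M (Pi.single l 1) := by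
    intro M c
    conv_lhs => rw [pi_eq_sum_univ' c]
    rw [map_sum]
    refine Finset.sum_congr rfl fun l _ => ?_
    rw [map_smul, smul_eq_mul]
  rw [h1, map_add]
  have e1 := key (L.comp (ContinuousLinearMap.inl ℝ _ _)) a
  have e2 := key (L.comp (ContinuousLinearMap.inr ℝ _ _)) b
  simp only [ContinuousLinearMap.comp_apply, ContinuousLinearMap.inl_apply,
    ContinuousLinearMap.inr_apply] at e1 e2 ⊢
  rw [e1, e2]

/-- For a C¹ family of skew-symmetric matrices `β(q,p)` and the
`β`-twisted vertical fields `D̃^i = Q^i + Σ_j β^{ij} P_j`, the flat Levi-Civita bracket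
(characterized by `η₀(⟦X,Y⟧(x),Z) = η₀([X,Y](x),Z) + η₀(DX(x)Z, Y(x))`) satisfies
`⟦D̃^i, D̃^j⟧ = Σ_k (∂β^{ij}/∂q^k) D̃^k + Σ_k 𝓡^{ijk} P_k`, with `𝓡` the
locally non-geometric `R`-flux and `∂β^{ij}/∂q^k` the `Q`-flux. -/
theorem stmt16 {d : ℕ}
    (β : Fin d → Fin d → (((Fin d → ℝ) × (Fin d → ℝ)) → ℝ))
    (hβ1 : ∀ i j : Fin d, ContDiff ℝ 1 (β i j))
    (hskew : ∀ (i j : Fin d) (x : (Fin d → ℝ) × (Fin d → ℝ)), β i j x = -(β j i x))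
    (Dt : Fin d → ((Fin d → ℝ) × (Fin d → ℝ)) → ((Fin d → ℝ) × (Fin d → ℝ)))
    (hDt : ∀ (i : Fin d) (x : (Fin d → ℝ) × (Fin d → ℝ)),
      Dt i x = ((fun j => β i j x), Pi.single i 1))
    (R : Fin d → Fin d → Fin d → (((Fin d → ℝ) × (Fin d → ℝ)) → ℝ))
    (hR : ∀ (i j k : Fin d) (x : (Fin d → ℝ) × (Fin d → ℝ)),
      R i j k x = fderiv ℝ (β j k) x (0, Pi.single i 1)
        + fderiv ℝ (β k i) x (0, Pi.single j 1)
        + fderiv ℝ (β i j) x (0, Pi.single k 1)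
        + ∑ l, (β i l x * fderiv ℝ (β j k) x (Pi.single l 1, 0)
          + β j l x * fderiv ℝ (β k i) x (Pi.single l 1, 0)
          + β k l x * fderiv ℝ (β i j) x (Pi.single l 1, 0))) :
    ∀ (i j : Fin d) (x Z : (Fin d → ℝ) × (Fin d → ℝ)),
      eta0 (∑ k, fderiv ℝ (β i j) x (Pi.single k 1, 0) • Dt k x
          + ∑ k, R i j k x • (((Pi.single k 1, 0)) : (Fin d → ℝ) × (Fin d → ℝ))) Z
        = eta0 (lieBracket (Dt i) (Dt j) x) Z + eta0 (fderiv ℝ (Dt i) x Z) (Dt j x) := by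
  intro i j x Z
  have hf : ∀ i v, fderiv ℝ (Dt i) x v = ((fun k => fderiv ℝ (β i k) x v), 0) := by
    intro i v
    have h0 : Dt i = fun y => ((fun k => β i k y), Pi.single i 1) := funext (hDt i)
    have h1 : HasFDerivAt (fun y => (fun k => β i k y))
        (ContinuousLinearMap.pi fun k => fderiv ℝ (β i k) x) x :=
      hasFDerivAt_pi.2 fun k => ((hβ1 i k).differentiable (by simp) x).hasFDerivAt
    have h2 := h1.prodMk (hasFDerivAt_const (Pi.single i 1 : Fin d → ℝ) x)
    rw [h0, h2.fderiv]
    rfl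
  have hs : ∀ i k v, fderiv ℝ (β i k) x v = - fderiv ℝ (β k i) x v := by
    intro i k v
    have h0 : β i k = fun y => - β k i y := funext (hskew i k)
    rw [h0, fderiv_fun_neg]
    rfl
  have hA : (∑ k, fderiv ℝ (β i j) x (Pi.single k 1, 0) • Dt k x
          + ∑ k, R i j k x • (((Pi.single k 1, 0)) : (Fin d → ℝ) × (Fin d → ℝ)))
      = ((fun k => fderiv ℝ (β j k) x (Dt i x) - fderiv ℝ (β i k) x (Dt j x)
          + fderiv ℝ (β i j) x (0, Pi.single k 1)),
         (fun k => fderiv ℝ (β i j) x (Pi.single k 1, 0))) := by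
    ext k
    · simp only [Prod.fst_add, Prod.fst_sum, Prod.smul_fst, Pi.add_apply, Finset.sum_apply,
        Pi.smul_apply, smul_eq_mul, hDt, hR, clm_decomp _ (fun j => β _ j x), Pi.single_apply,
        mul_ite, ite_mul, mul_one, mul_zero, one_mul, zero_mul, Finset.sum_ite_eq,
        Finset.sum_ite_eq', Finset.mem_univ, if_true, Finset.sum_add_distrib]
      rw [hs k i]
      have t1 : ∑ l, β j l x * fderiv ℝ (β k i) x (Pi.single l 1, 0)
          = - ∑ l, β j l x * fderiv ℝ (β i k) x (Pi.single l 1, 0) := by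
        rw [← Finset.sum_neg_distrib]
        exact Finset.sum_congr rfl fun l _ => by rw [hs k i]; ring
      have t2 : ∑ l, β k l x * fderiv ℝ (β i j) x (Pi.single l 1, 0)
          = - ∑ l, fderiv ℝ (β i j) x (Pi.single l 1, 0) * β l k x := by
        rw [← Finset.sum_neg_distrib]
        exact Finset.sum_congr rfl fun l _ => by rw [hskew k l]; ring
      rw [t1, t2]
      ring
    · simp [Prod.snd_sum, hDt, Pi.single_apply]
  rw [hA]
  have hZ := clm_decomp (fderiv ℝ (β i j) x) Z.1 Z.2
  simp only [eta0, lieBracket, hf, dotProduct, Prod.fst_sub, Prod.snd_sub, Pi.sub_apply,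
    Pi.zero_apply, sub_zero, zero_mul, Finset.sum_const_zero, add_zero, add_mul,
    Finset.sum_add_distrib]
  have h3 : ∑ k, fderiv ℝ (β i k) x Z * (Dt j x).2 k = fderiv ℝ (β i j) x Z := by
    simp [hDt, Pi.single_apply]
  rw [h3]
  rw [Prod.mk.eta] at hZ
  rw [hZ]
  simp only [mul_comm (Z.1 _), mul_comm (Z.2 _)]
  ring
end

section
/- Let B, β : ℝ^d × ℝ^d → ℝ^{d×d} be C¹ families of skew-symmetric matrices (B_{ij} = −B_{ji}, β^{ij} = −β^{ji}), and define the vector fields D_i := P_i + Σ_j B_{ij} Q^j and D̃^i := Q^i + Σ_j β^{ij} D_j on ℝ^d × ℝ^d. Then the flat Levi-Civita bracket expressed in the (D, D̃) frame exhibits the generalized fluxes of double field theory: ⟦D_i, D_j⟧(x) = Σ_k 𝓗_{ijk}(x) · D̃^k(x) + Σ_k 𝓕_{ij}{}^k(x) · D_k(x), where 𝓗_{ijk} := ∂B_{jk}/∂q^i + ∂B_{ki}/∂q^j + ∂B_{ij}/∂q^k + Σ_m (B_{im} ∂B_{jk}/∂p_m + B_{jm} ∂B_{ki}/∂p_m +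 B_{km} ∂B_{ij}/∂p_m) and 𝓕_{ij}{}^k := ∂B_{ij}/∂p_k + Σ_m β^{km} 𝓗_{mij}. -/
open Matrix

/-- For C¹ families of skew-symmetric matrices `B(q,p)` and `β(q,p)`,
with `D_i = P_i + Σ_j B_{ij} Q^j` and `D̃^i = Q^i + Σ_j β^{ij} D_j`, the flat
Levi-Civita bracket (characterized by
`η₀(⟦X,Y⟧(x),Z) = η₀([X,Y](x),Z) + η₀(DX(x)Z, Y(x))`) expressed in the `(D, D̃)` frame
exhibits the generalized fluxes:
`⟦D_i, D_j⟧ = Σ_k 𝓗_{ijk} D̃^k + Σ_k 𝓕_{ij}{}^k D_k` with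
`𝓕_{ij}{}^k = ∂B_{ij}/∂p_k + Σ_m β^{km} 𝓗_{mij}`. -/
theorem stmt17 {d : ℕ}
    (B β : Fin d → Fin d → (((Fin d → ℝ) × (Fin d → ℝ)) → ℝ))
    (hB1 : ∀ i j : Fin d, ContDiff ℝ 1 (B i j))
    (hβ1 : ∀ i j : Fin d, ContDiff ℝ 1 (β i j))
    (hBskew : ∀ (i j : Fin d) (x : (Fin d → ℝ) × (Fin d → ℝ)), B i j x = -(B j i x))
    (hβskew : ∀ (i j : Fin d) (x : (Fin d → ℝ) × (Fin d → ℝ)), β i j x = -(β j i x))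
    (D Dt : Fin d → ((Fin d → ℝ) × (Fin d → ℝ)) → ((Fin d → ℝ) × (Fin d → ℝ)))
    (hD : ∀ (i : Fin d) (x : (Fin d → ℝ) × (Fin d → ℝ)),
      D i x = (Pi.single i 1, fun j => B i j x))
    (hDt : ∀ (i : Fin d) (x : (Fin d → ℝ) × (Fin d → ℝ)),
      Dt i x = (((0, Pi.single i 1)) : (Fin d → ℝ) × (Fin d → ℝ)) + ∑ j, β i j x • D j x)
    (H : Fin d → Fin d → Fin d → (((Fin d → ℝ) × (Fin d → ℝ)) → ℝ))
    (hH : ∀ (i j k : Fin d) (x : (Fin d → ℝ) × (Fin d → ℝ)),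
      H i j k x = fderiv ℝ (B j k) x (Pi.single i 1, 0)
        + fderiv ℝ (B k i) x (Pi.single j 1, 0)
        + fderiv ℝ (B i j) x (Pi.single k 1, 0)
        + ∑ m, (B i m x * fderiv ℝ (B j k) x (0, Pi.single m 1)
          + B j m x * fderiv ℝ (B k i) x (0, Pi.single m 1)
          + B k m x * fderiv ℝ (B i j) x (0, Pi.single m 1)))
    (F : Fin d → Fin d → Fin d → (((Fin d → ℝ) × (Fin d → ℝ)) → ℝ))
    (hF : ∀ (i j k : Fin d) (x : (Fin d → ℝ) × (Fin d → ℝ)),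
      F i j k x = fderiv ℝ (B i j) x (0, Pi.single k 1)
        + ∑ m, β k m x * H m i j x) :
    ∀ (i j : Fin d) (x Z : (Fin d → ℝ) × (Fin d → ℝ)),
      eta0 (∑ k, H i j k x • Dt k x + ∑ k, F i j k x • D k x) Z
        = eta0 (lieBracket (D i) (D j) x) Z + eta0 (fderiv ℝ (D i) x Z) (D j x) := by
  intro i j x Z
  have hL : ∀ (L : ((Fin d → ℝ) × (Fin d → ℝ)) →L[ℝ] ℝ) (W : (Fin d → ℝ) × (Fin d → ℝ)),
      L W = ∑ k, W.1 k * L (Pi.single k 1, 0) + ∑ k, W.2 k * L (0, Pi.single k 1) := by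
    intro L W
    have hW : W = ∑ k, W.1 k • ((Pi.single k 1, 0) : (Fin d → ℝ) × (Fin d → ℝ))
        + ∑ k, W.2 k • ((0, Pi.single k 1) : (Fin d → ℝ) × (Fin d → ℝ)) := by
      ext l <;> simp [Prod.fst_sum, Prod.snd_sum, Finset.sum_apply, Pi.single_apply]
    conv_lhs => rw [hW]
    simp only [map_add, map_sum, map_smul, smul_eq_mul]
  have hfD : ∀ (a : Fin d) (W : (Fin d → ℝ) × (Fin d → ℝ)),
      fderiv ℝ (D a) x W = (0, fun k => fderiv ℝ (B a k) x W) := by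
    intro a W
    have h1 : D a = fun y => (Pi.single a 1, fun k => B a k y) := funext (hD a)
    have h2 : HasFDerivAt (D a) ((0 : ((Fin d → ℝ) × (Fin d → ℝ)) →L[ℝ] (Fin d → ℝ)).prod
        (ContinuousLinearMap.pi fun k => fderiv ℝ (B a k) x)) x := by
      rw [h1]
      refine (hasFDerivAt_const _ _).prodMk (hasFDerivAt_pi.2 fun k => ?_)
      exact ((hB1 a k).differentiable (by norm_num) x).hasFDerivAt
    rw [h2.fderiv]
    rfl
  have hskew : ∀ (a b : Fin d) (W : (Fin d → ℝ) × (Fin d → ℝ)),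
      fderiv ℝ (B a b) x W = - fderiv ℝ (B b a) x W := by
    intro a b W
    have h1 : B a b = -(B b a) := funext (hBskew a b)
    rw [h1, fderiv_neg]
    rfl
  have hHd : ∀ a b c, H a b c x = fderiv ℝ (B b c) x (D a x) + fderiv ℝ (B c a) x (D b x)
      + fderiv ℝ (B a b) x (D c x) := by
    intro a b c
    rw [hH, hL _ (D a x), hL _ (D b x), hL _ (D c x)]
    simp only [hD, Pi.single_apply, ite_mul, one_mul, zero_mul, Finset.sum_ite_eq',
      Finset.sum_ite_eq, Finset.mem_univ, if_true, Finset.sum_add_distrib]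
    ring
  have hcyc : ∀ a, H a i j x = H i j a x := by
    intro a
    rw [hHd, hHd]
    ring
  have hvec : (∑ k, H i j k x • Dt k x + ∑ k, F i j k x • D k x)
      = ∑ k, H i j k x • ((0, Pi.single k 1) : (Fin d → ℝ) × (Fin d → ℝ))
        + ∑ k, fderiv ℝ (B i j) x (0, Pi.single k 1) • D k x := by
    simp only [hDt, hF, smul_add, add_smul, Finset.sum_add_distrib, Finset.smul_sum,
      Finset.sum_smul, smul_smul, hcyc]
    have : ∑ k, ∑ m, (H i j k x * β k m x) • D m x
        = - ∑ k, ∑ m, (β k m x * H i j m x) • D k x := by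
      rw [Finset.sum_comm, ← Finset.sum_neg_distrib]
      refine Finset.sum_congr rfl fun k _ => ?_
      rw [← Finset.sum_neg_distrib]
      refine Finset.sum_congr rfl fun m _ => ?_
      rw [hβskew m k, ← neg_smul]
      congr 1
      ring
    rw [this]
    abel
  have hlin : ∀ (V : (Fin d → ℝ) × (Fin d → ℝ)), eta0 V Z
      = ∑ k, V.1 k * Z.2 k + ∑ k, V.2 k * Z.1 k := fun V => rfl
  have hadd : ∀ U V : (Fin d → ℝ) × (Fin d → ℝ), eta0 (U + V) Z = eta0 U Z + eta0 V Z := by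
    intro U V
    simp only [eta0, Prod.fst_add, Prod.snd_add, add_dotProduct]
    ring
  have hsum : ∀ (c : Fin d → ℝ) (V : Fin d → (Fin d → ℝ) × (Fin d → ℝ)),
      eta0 (∑ k, c k • V k) Z = ∑ k, c k * eta0 (V k) Z := by
    intro c V
    simp only [eta0, Prod.fst_sum, Prod.snd_sum, sum_dotProduct, Prod.smul_fst, Prod.smul_snd,
      smul_dotProduct, smul_eq_mul, mul_add, Finset.sum_add_distrib]
  have hQ : ∀ k, eta0 ((0, Pi.single k 1) : (Fin d → ℝ) × (Fin d → ℝ)) Z = Z.1 k := by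
    intro k
    simp [eta0]
  have hDZ : ∀ k, eta0 (D k x) Z = Z.2 k + ∑ l, B k l x * Z.1 l := by
    intro k
    rw [hD]
    simp [eta0, dotProduct, Pi.single_apply]
  have hR1 : eta0 (lieBracket (D i) (D j) x) Z
      = ∑ k, (fderiv ℝ (B j k) x (D i x) - fderiv ℝ (B i k) x (D j x)) * Z.1 k := by
    simp [lieBracket, hfD, eta0, dotProduct]
  have hR2 : eta0 (fderiv ℝ (D i) x Z) (D j x) = fderiv ℝ (B i j) x Z := by
    rw [hfD, hD]
    simp [eta0]
  have hDk : ∀ k, fderiv ℝ (B i j) x (D k x) = fderiv ℝ (B i j) x (Pi.single k 1, 0)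
      + ∑ m, B k m x * fderiv ℝ (B i j) x (0, Pi.single m 1) := by
    intro k
    rw [hL _ (D k x)]
    simp [hD, Pi.single_apply]
  have hcancel : ∑ k, fderiv ℝ (B i j) x (0, Pi.single k 1) * ∑ l, B k l x * Z.1 l
      = - ∑ k, (∑ m, B k m x * fderiv ℝ (B i j) x (0, Pi.single m 1)) * Z.1 k := by
    simp only [Finset.mul_sum, Finset.sum_mul]
    rw [Finset.sum_comm, ← Finset.sum_neg_distrib]
    refine Finset.sum_congr rfl fun k _ => ?_
    rw [← Finset.sum_neg_distrib]
    refine Finset.sum_congr rfl fun m _ => ?_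
    rw [hBskew m k]
    ring
  rw [hvec, hadd, hsum, hsum, hR1, hR2, hL _ Z]
  simp only [hQ, hDZ, mul_add, Finset.sum_add_distrib]
  rw [hcancel]
  have hHk : ∀ k, H i j k x * Z.1 k
      = (fderiv ℝ (B j k) x (D i x) - fderiv ℝ (B i k) x (D j x)) * Z.1 k
        + Z.1 k * fderiv ℝ (B i j) x (Pi.single k 1, 0)
        + (∑ m, B k m x * fderiv ℝ (B i j) x (0, Pi.single m 1)) * Z.1 k := by
    intro k
    rw [hHd, hskew k i, hDk]
    ring
  simp only [hHk, Finset.sum_add_distrib]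
  simp only [mul_comm (Z.2 _)]
  ring
end
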